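/- There exists a constant C > 0 such that for every e ∈ [0,1/2] and every ℓ ∈ ℝ, |u(e,ℓ) − ℓ − e·sin(ℓ) − (e²/2)·sin(2ℓ)| ≤ C·e³; that is, uniformly in ℓ, the eccentric anomaly has the expansion u(e,ℓ) = ℓ + e·sin(ℓ) + (e²/2)·sin(2ℓ) + O(e³). -/

import Mathlib

/-- There is a constant `C > 0` such that for every
`e ∈ [0,1/2]` and every `ℓ ∈ ℝ`,
`|u(e,ℓ) − ℓ − e·sin ℓ − (e²/2)·sin(2ℓ)| ≤ C·e³`, where `u = U` is the unique
solution of Kepler's equation. -/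
theorem stmt_2 (U : ℝ → ℝ → ℝ)
    (hU : ∀ e ∈ Set.Ico (0:ℝ) 1, ∀ ℓ : ℝ, U e ℓ - e * Real.sin (U e ℓ) = ℓ) :
    ∃ C > 0, ∀ e ∈ Set.Icc (0:ℝ) (1/2), ∀ ℓ : ℝ,
      |U e ℓ - ℓ - e * Real.sin ℓ - e ^ 2 / 2 * Real.sin (2 * ℓ)| ≤ C * e ^ 3 := by
  refine ⟨4, by norm_num, ?_⟩
  rintro e ⟨he0, he1⟩ ℓ
  have h := hU e ⟨he0, by linarith⟩ ℓ
  generalize U e ℓ = u at h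
  obtain ⟨d, hd⟩ : ∃ d, d = u - ℓ := ⟨_, rfl⟩
  have hu : u = ℓ + d := by linarith
  have hde : d = e * Real.sin u := by linarith
  have hdabs : |d| ≤ e := by
    rw [hde, abs_mul, abs_of_nonneg he0]
    exact mul_le_of_le_one_right he0 (Real.abs_sin_le_one u)
  have hsin : Real.sin u = Real.sin ℓ * Real.cos d + Real.cos ℓ * Real.sin d := by
    rw [hu, Real.sin_add]
  have hd2 : d ^ 2 ≤ e ^ 2 := sq_le_sq' (by linarith [neg_abs_le d]) (by linarith [le_abs_self d])
  have hc : |Real.cos d - 1| ≤ e ^ 2 / 2 := by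
    rw [abs_le]
    constructor
    · linarith [Real.one_sub_sq_div_two_le_cos (x := d)]
    · nlinarith [Real.cos_le_one d, sq_nonneg e]
  have hs : |Real.sin d| ≤ e := Real.abs_sin_le_abs.trans hdabs
  have hs3 : |Real.sin d - d| ≤ e ^ 2 := by
    have hb := Real.sin_bound (x := d) (by linarith)
    have h3 : |d| ^ 3 ≤ e ^ 3 := by gcongr
    have h4 : |d| ^ 5 ≤ e ^ 5 := by gcongr
    have e3 : e ^ 3 ≤ e ^ 2 := pow_le_pow_of_le_one he0 (by linarith) (by norm_num)
    have e4 : e ^ 5 ≤ e ^ 2 := pow_le_pow_of_le_one he0 (by linarith) (by norm_num)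
    rw [← abs_pow] at h3
    rw [abs_le] at hb h3 ⊢
    constructor <;> linarith [sq_nonneg e]
  have key : ∀ a b : ℝ, |a| ≤ 1 → |a * b| ≤ |b| := fun a b ha => by
    rw [abs_mul]; exact mul_le_of_le_one_left (abs_nonneg b) ha
  have k1 := (key _ (Real.cos d - 1) (Real.abs_sin_le_one ℓ)).trans hc
  have k2 := (key _ (Real.sin d) (Real.abs_cos_le_one ℓ)).trans hs
  have k3 := (key _ (Real.sin d - d) (Real.abs_cos_le_one ℓ)).trans hs3
  have k4 : |Real.sin u - Real.sin ℓ| ≤ 2 * e := by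
    have : Real.sin u - Real.sin ℓ
      = Real.sin ℓ * (Real.cos d - 1) + Real.cos ℓ * Real.sin d := by rw [hsin]; ring
    rw [this]
    refine (abs_add_le _ _).trans ?_
    nlinarith
  have k5 := (key _ (Real.sin u - Real.sin ℓ) (Real.abs_cos_le_one ℓ)).trans k4
  have main : u - ℓ - e * Real.sin ℓ - e ^ 2 / 2 * Real.sin (2 * ℓ)
      = e * (Real.sin ℓ * (Real.cos d - 1) + Real.cos ℓ * (Real.sin d - d)
        + e * (Real.cos ℓ * (Real.sin u - Real.sin ℓ))) := by
    rw [Real.sin_two_mul]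
    linear_combination (1 : ℝ) * h + e * hsin + e * Real.cos ℓ * hde
  rw [main, abs_mul, abs_of_nonneg he0]
  have k6 : |e * (Real.cos ℓ * (Real.sin u - Real.sin ℓ))| ≤ e * (2 * e) := by
    rw [abs_mul, abs_of_nonneg he0]
    exact mul_le_mul_of_nonneg_left k5 he0
  have k7 : |Real.sin ℓ * (Real.cos d - 1) + Real.cos ℓ * (Real.sin d - d)
        + e * (Real.cos ℓ * (Real.sin u - Real.sin ℓ))| ≤ 4 * e ^ 2 := by
    refine (abs_add_three _ _ _).trans ?_
    nlinarith [sq_nonneg e]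
  calc _ ≤ e * (4 * e ^ 2) := mul_le_mul_of_nonneg_left k7 he0
    _ = 4 * e ^ 3 := by ring
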